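/- Let q/(q+1) < p < ∞, 1 < q < ∞, and r = pq/(pq+p−q). Then for all x ∈ [0, π_{r,q}/2), cosh_{p,q}(x) = 1 / (cos_{r,q}(x))^{r/p}. -/

import Mathlib

open MeasureTheory Set
open scoped ENNReal

/-- `genF p q y = ∫_0^y (1 - t^q)^(-1/p) dt`, whose inverse is the generalized sine. -/
noncomputable def genF (p q y : ℝ) : ℝ := ∫ t in (0:ℝ)..y, (1 - t ^ q) ^ (-(1 / p))

/-- `genG p q y = ∫_0^y (1 + t^q)^(-1/p) dt`, whose inverse is the generalized hyperbolic sine. -/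
noncomputable def genG (p q y : ℝ) : ℝ := ∫ t in (0:ℝ)..y, (1 + t ^ q) ^ (-(1 / p))

/-- The generalized π, `π_{p,q} = 2∫_0^1 (1 - t^q)^(-1/p) dt`, as an extended real number
(it is `∞` when `q/(q+1) < p ≤ 1`). -/
noncomputable def genPi (p q : ℝ) : ℝ≥0∞ :=
  2 * ∫⁻ t in Ioo (0:ℝ) 1, ENNReal.ofReal ((1 - t ^ q) ^ (-(1 / p)))

/-- The generalized sine `sin_{p,q}`: the inverse of `genF p q`, which maps `[0,1)` onto
`[0, π_{p,q}/2)`. -/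
noncomputable def gsin (p q : ℝ) : ℝ → ℝ := Function.invFunOn (genF p q) (Ico 0 1)

/-- The generalized cosine `cos_{p,q} x = (d/dx) sin_{p,q} x` (one-sided at `x = 0`). -/
noncomputable def gcos (p q x : ℝ) : ℝ := derivWithin (gsin p q) (Ici 0) x

/-- The generalized hyperbolic sine `sinh_{p,q}`: the inverse of `genG p q`, which maps
`[0,∞)` onto `[0, π_{r,q}/2)` where `r = pq/(pq+p-q)`. -/
noncomputable def gsinh (p q : ℝ) : ℝ → ℝ := Function.invFunOn (genG p q) (Ici 0)

/-- The generalized hyperbolic cosine `cosh_{p,q} x = (d/dx) sinh_{p,q} x`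
(one-sided at `x = 0`). -/
noncomputable def gcosh (p q x : ℝ) : ℝ := derivWithin (gsinh p q) (Ici 0) x

/-- The substitution `s ↦ s (1 - s^q)^(-1/q)`, which carries `sin_{r,q}` to `sinh_{p,q}`. -/
noncomputable def sinToSinh (q s : ℝ) : ℝ := s * (1 - s ^ q) ^ (-(1 / q))

lemma one_sub_rpow_pos {q s : ℝ} (hq : 0 < q) (hs : s ∈ Ioo (-1 : ℝ) 1) : 0 < 1 - s ^ q := by
  have h1 : |s ^ q| ≤ |s| ^ q := Real.abs_rpow_le_abs_rpow s q
  have h2 : |s| ^ q < 1 := Real.rpow_lt_one (abs_nonneg s) (abs_lt.2 ⟨hs.1, hs.2⟩) hq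
  linarith [le_abs_self (s ^ q)]

lemma continuousOn_one_sub_rpow_rpow {q : ℝ} (hq : 0 < q) (a : ℝ) :
    ContinuousOn (fun t : ℝ ↦ (1 - t ^ q) ^ a) (Ioo (-1) 1) :=
  ContinuousOn.rpow_const
    (continuous_const.sub (Real.continuous_rpow_const hq.le)).continuousOn
    fun _ hs ↦ Or.inl (one_sub_rpow_pos hq hs).ne'

lemma uIcc_subset_Ioo {a b s t : ℝ} (hs : s ∈ Ioo a b) (ht : t ∈ Ioo a b) :
    uIcc s t ⊆ Ioo a b := ordConnected_Ioo.uIcc_subset hs ht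

lemma intervalIntegrable_one_sub_rpow_rpow {q : ℝ} (hq : 0 < q) (a : ℝ) {s t : ℝ}
    (hs : s ∈ Ioo (-1 : ℝ) 1) (ht : t ∈ Ioo (-1 : ℝ) 1) :
    IntervalIntegrable (fun t : ℝ ↦ (1 - t ^ q) ^ a) volume s t :=
  ((continuousOn_one_sub_rpow_rpow hq a).mono (uIcc_subset_Ioo hs ht)).intervalIntegrable

lemma hasDerivAt_genF {q : ℝ} (r : ℝ) (hq : 0 < q) {s : ℝ} (hs : s ∈ Ioo (-1 : ℝ) 1) :
    HasDerivAt (genF r q) ((1 - s ^ q) ^ (-(1 / r))) s :=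
  intervalIntegral.integral_hasDerivAt_right
    (intervalIntegrable_one_sub_rpow_rpow hq _ (by norm_num) hs)
    ((continuousOn_one_sub_rpow_rpow hq _).stronglyMeasurableAtFilter isOpen_Ioo s hs)
    ((continuousOn_one_sub_rpow_rpow hq _).continuousAt (isOpen_Ioo.mem_nhds hs))

lemma sub_le_genF_sub {q r : ℝ} (hq : 0 < q) (hr : 0 < r) {a b : ℝ} (ha : 0 ≤ a) (hab : a ≤ b)
    (hb : b < 1) : b - a ≤ genF r q b - genF r q a := by
  have mem {t : ℝ} (h0 : 0 ≤ t) (h1 : t ≤ b) : t ∈ Ioo (-1 : ℝ) 1 :=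
    ⟨by linarith, by linarith⟩
  have h0 : (0 : ℝ) ∈ Ioo (-1 : ℝ) 1 := by norm_num
  have hma := mem ha hab
  have hmb := mem (ha.trans hab) le_rfl
  unfold genF
  rw [intervalIntegral.integral_interval_sub_left
    (intervalIntegrable_one_sub_rpow_rpow hq _ h0 hmb)
    (intervalIntegrable_one_sub_rpow_rpow hq _ h0 hma)]
  calc b - a = ∫ _ in a..b, (1 : ℝ) := by simp
    _ ≤ _ := by
      refine intervalIntegral.integral_mono_on hab (by simp)
        (intervalIntegrable_one_sub_rpow_rpow hq _ hma hmb) fun t ht ↦ ?_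
      have h0t := ha.trans ht.1
      refine Real.one_le_rpow_of_pos_of_le_one_of_nonpos
        (one_sub_rpow_pos hq (mem h0t ht.2)) ?_ ?_
      · linarith [Real.rpow_nonneg h0t q]
      · have := one_div_pos.2 hr
        linarith

lemma strictMonoOn_genF {q r : ℝ} (hq : 0 < q) (hr : 0 < r) :
    StrictMonoOn (genF r q) (Ico 0 1) := fun a ha b hb hab ↦ by
  linarith [sub_le_genF_sub hq hr ha.1 hab.le hb.2]

lemma genF_zero (r q : ℝ) : genF r q 0 = 0 := by simp [genF]

lemma exists_genF_eq {q : ℝ} (r : ℝ) (hq : 0 < q) {x y : ℝ} (hy : y ∈ Ico (0 : ℝ) 1)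
    (hx0 : 0 ≤ x) (hxy : x ≤ genF r q y) : ∃ s ∈ Ico (0 : ℝ) 1, genF r q s = x := by
  have hc : ContinuousOn (genF r q) (Icc 0 y) := fun s hs ↦
    (hasDerivAt_genF r hq ⟨by linarith [hs.1], by linarith [hs.2, hy.2]⟩).continuousAt
      |>.continuousWithinAt
  obtain ⟨s, hs, rfl⟩ := intermediate_value_Icc hy.1 hc ⟨by rwa [genF_zero], hxy⟩
  exact ⟨s, ⟨hs.1, hs.2.trans_lt hy.2⟩, rfl⟩

lemma ofReal_genF {q : ℝ} (r : ℝ) (hq : 0 < q) {y : ℝ} (hy : y ∈ Ico (0 : ℝ) 1) :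
    ENNReal.ofReal (genF r q y) =
      ∫⁻ t in Ioc (0 : ℝ) y, ENNReal.ofReal ((1 - t ^ q) ^ (-(1 / r))) := by
  have hi := intervalIntegrable_one_sub_rpow_rpow hq (-(1 / r)) (s := 0) (t := y) (by norm_num)
    ⟨by linarith [hy.1], hy.2⟩
  rw [genF, intervalIntegral.integral_of_le hy.1]
  refine ofReal_integral_eq_lintegral_ofReal
    ((intervalIntegrable_iff_integrableOn_Ioc_of_le hy.1).1 hi) ?_
  filter_upwards [ae_restrict_mem measurableSet_Ioc] with t ht
  exact Real.rpow_nonneg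
    (one_sub_rpow_pos hq ⟨by linarith [ht.1], ht.2.trans_lt hy.2⟩).le _

lemma exists_lt_genF {q : ℝ} (r : ℝ) (hq : 0 < q) {x : ℝ} (hx0 : 0 ≤ x)
    (hx : ENNReal.ofReal x < genPi r q / 2) : ∃ y ∈ Ico (0 : ℝ) 1, x < genF r q y := by
  have hS : Ioo (0 : ℝ) 1 = ⋃ n : ℕ, Ioc 0 (1 - 1 / ((n : ℝ) + 1)) := by
    ext t
    simp only [mem_Ioo, mem_iUnion, mem_Ioc]
    refine ⟨fun ⟨h0, h1⟩ ↦ ?_, fun ⟨n, h0, h1⟩ ↦ ⟨h0, ?_⟩⟩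
    · obtain ⟨n, hn⟩ := exists_nat_one_div_lt (sub_pos.2 h1)
      exact ⟨n, h0, by linarith⟩
    · linarith [Nat.one_div_pos_of_nat (α := ℝ) (n := n)]
  have hmono : Monotone fun n : ℕ ↦ Ioc (0 : ℝ) (1 - 1 / ((n : ℝ) + 1)) := fun m n hmn ↦
    Ioc_subset_Ioc_right (sub_le_sub_left (Nat.one_div_le_one_div hmn) 1)
  rw [genPi, mul_comm, ENNReal.mul_div_cancel_right two_ne_zero ENNReal.ofNat_ne_top, hS,
    setLIntegral_iUnion_of_directed _ hmono.directed_le, lt_iSup_iff] at hx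
  obtain ⟨n, hn⟩ := hx
  have hpos := Nat.one_div_pos_of_nat (α := ℝ) (n := n)
  have hle : 1 / ((n : ℝ) + 1) ≤ 1 := by
    simpa using Nat.one_div_le_one_div (α := ℝ) (Nat.zero_le n)
  have hy : 1 - 1 / ((n : ℝ) + 1) ∈ Ico (0 : ℝ) 1 := ⟨by linarith, by linarith⟩
  rw [← ofReal_genF r hq hy] at hn
  exact ⟨_, hy, ((ENNReal.ofReal_lt_ofReal_iff_of_nonneg hx0).1 hn)⟩

lemma gsin_genF {q r : ℝ} (hq : 0 < q) (hr : 0 < r) {s : ℝ} (hs : s ∈ Ico (0 : ℝ) 1) :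
    gsin r q (genF r q s) = s :=
  (strictMonoOn_genF hq hr).injOn.leftInvOn_invFunOn hs

lemma hasDerivWithinAt_gsin {q r : ℝ} (hq : 0 < q) (hr : 0 < r) {s y : ℝ}
    (hs : s ∈ Ico (0 : ℝ) 1) (hy : y ∈ Ico (0 : ℝ) 1) (hsy : genF r q s < genF r q y) :
    HasDerivWithinAt (gsin r q) ((1 - s ^ q) ^ (1 / r)) (Ici 0) (genF r q s) := by
  have hs' : s ∈ Ioo (-1 : ℝ) 1 := ⟨by linarith [hs.1], hs.2⟩
  have hpos := one_sub_rpow_pos hq hs'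
  have h0 : 0 ≤ genF r q s := by
    have := sub_le_genF_sub hq hr le_rfl hs.1 hs.2
    rw [genF_zero] at this
    linarith [hs.1]
  have hev : ∀ᶠ u in nhdsWithin (genF r q s) (Ici 0), ∃ v ∈ Ico (0 : ℝ) 1, genF r q v = u := by
    filter_upwards [self_mem_nhdsWithin, mem_nhdsWithin_of_mem_nhds (Iio_mem_nhds hsy)]
      with u hu hu'
    exact exists_genF_eq r hq hy hu (le_of_lt hu')
  have hcont : Filter.Tendsto (gsin r q) (nhdsWithin (genF r q s) (Ici 0)) (nhds s) := by
    rw [tendsto_iff_dist_tendsto_zero]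
    have hlim : Filter.Tendsto (fun u ↦ dist u (genF r q s))
        (nhdsWithin (genF r q s) (Ici 0)) (nhds 0) :=
      (tendsto_iff_dist_tendsto_zero.1 Filter.tendsto_id).mono_left nhdsWithin_le_nhds
    refine squeeze_zero' (Filter.Eventually.of_forall fun _ ↦ dist_nonneg) ?_ hlim
    filter_upwards [hev] with u ⟨v, hv, hvu⟩
    rw [← hvu, gsin_genF hq hr hv, Real.dist_eq, Real.dist_eq]
    rcases le_total s v with h | h
    · have := sub_le_genF_sub hq hr hs.1 h hv.2
      rw [abs_of_nonneg (sub_nonneg.2 h)]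
      exact this.trans (le_abs_self _)
    · have := sub_le_genF_sub hq hr hv.1 h hs.2
      rw [abs_sub_comm, abs_sub_comm (genF r q v), abs_of_nonneg (sub_nonneg.2 h)]
      exact this.trans (le_abs_self _)
  have hd := (hasDerivAt_genF r hq hs').hasFDerivAt_equiv (Real.rpow_pos_of_pos hpos _).ne'
  have hg := gsin_genF hq hr hs
  have key := HasFDerivWithinAt.of_local_left_inverse (g := gsin r q) (s := Ici 0) (t := univ)
    (a := genF r q s) (f := genF r q) (by rwa [hg, nhdsWithin_univ])
    (by rw [hg]; exact hd.hasFDerivWithinAt) h0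
    (by filter_upwards [hev] with u ⟨v, hv, hvu⟩; rw [← hvu, gsin_genF hq hr hv])
  refine key.hasDerivWithinAt.congr_deriv ?_
  simp [Real.rpow_neg hpos.le]

lemma sinToSinh_nonneg {q s : ℝ} (hq : 0 < q) (hs : s ∈ Ico (0 : ℝ) 1) : 0 ≤ sinToSinh q s :=
  mul_nonneg hs.1
    (Real.rpow_nonneg (one_sub_rpow_pos hq ⟨by linarith [hs.1], hs.2⟩).le _)

lemma hasDerivAt_sinToSinh {q s : ℝ} (hq : 1 < q) (hs : s ∈ Ico (0 : ℝ) 1) :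
    HasDerivAt (sinToSinh q) ((1 - s ^ q) ^ (-(1 / q) - 1)) s := by
  have hpos := one_sub_rpow_pos (zero_lt_one.trans hq) (s := s) ⟨by linarith [hs.1], hs.2⟩
  have h1 : HasDerivAt (fun t : ℝ ↦ 1 - t ^ q) (-(q * s ^ (q - 1))) s :=
    (Real.hasDerivAt_rpow_const (Or.inr hq.le)).const_sub 1
  have h2 := (hasDerivAt_id s).mul (h1.rpow_const (p := -(1 / q)) (Or.inl hpos.ne'))
  refine HasDerivAt.congr_deriv (f := sinToSinh q) h2 ?_
  have e1 : (1 - s ^ q) ^ (-(1 / q)) = (1 - s ^ q) ^ (-(1 / q) - 1) * (1 - s ^ q) := by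
    rw [Real.rpow_sub_one hpos.ne', div_mul_cancel₀ _ hpos.ne']
  have e2 : s * s ^ (q - 1) = s ^ q := by
    rcases hs.1.eq_or_lt with rfl | h
    · rw [zero_mul, Real.zero_rpow (by linarith)]
    · rw [Real.rpow_sub_one h.ne', mul_div_cancel₀ _ h.ne']
  have e3 : q * (1 / q) = 1 := by field_simp
  rw [e1, id]
  linear_combination (1 - s ^ q) ^ (-(1 / q) - 1) * (e2 * (q * (1 / q)) + s ^ q * e3)

lemma one_add_sinToSinh_rpow {q s : ℝ} (hq : 0 < q) (hs : s ∈ Ico (0 : ℝ) 1) :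
    1 + sinToSinh q s ^ q = (1 - s ^ q)⁻¹ := by
  have hpos := one_sub_rpow_pos hq (s := s) ⟨by linarith [hs.1], hs.2⟩
  rw [sinToSinh, Real.mul_rpow hs.1 (Real.rpow_nonneg hpos.le _), ← Real.rpow_mul hpos.le,
    show -(1 / q) * q = -1 by field_simp, Real.rpow_neg_one]
  field_simp
  ring

lemma continuousOn_one_add_rpow_rpow {q : ℝ} (hq : 0 < q) (a : ℝ) :
    ContinuousOn (fun t : ℝ ↦ (1 + t ^ q) ^ a) (Ici 0) :=
  ContinuousOn.rpow_const
    (continuous_const.add (Real.continuous_rpow_const hq.le)).continuousOn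
    fun _ hs ↦ Or.inl (by have := Real.rpow_nonneg (mem_Ici.1 hs) q; positivity)

lemma strictMonoOn_genG {q : ℝ} (p : ℝ) (hq : 0 < q) : StrictMonoOn (genG p q) (Ici 0) := by
  intro a ha b hb hab
  have hi {s t : ℝ} (hs : s ∈ Ici (0 : ℝ)) (ht : t ∈ Ici (0 : ℝ)) :
      IntervalIntegrable (fun t : ℝ ↦ (1 + t ^ q) ^ (-(1 / p))) volume s t :=
    ((continuousOn_one_add_rpow_rpow hq _).mono
      (ordConnected_Ici.uIcc_subset hs ht)).intervalIntegrable
  rw [← sub_pos, genG, genG, intervalIntegral.integral_interval_sub_left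
    (hi self_mem_Ici hb) (hi self_mem_Ici ha)]
  refine intervalIntegral.intervalIntegral_pos_of_pos_on (hi ha hb) (fun t ht ↦ ?_) hab
  have := Real.rpow_nonneg ((mem_Ici.1 ha).trans ht.1.le) q
  positivity

lemma genG_sinToSinh {p q r : ℝ} (hq : 1 < q) (hr : 1 / r = 1 + 1 / q - 1 / p) {s : ℝ}
    (hs : s ∈ Ico (0 : ℝ) 1) : genG p q (sinToSinh q s) = genF r q s := by
  have hq0 := zero_lt_one.trans hq
  have hsub : uIcc 0 s ⊆ Ico 0 1 := ordConnected_Ico.uIcc_subset (by norm_num) hs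
  have hsub' : uIcc 0 s ⊆ Ioo (-1 : ℝ) 1 :=
    hsub.trans fun t ht ↦ ⟨by linarith [ht.1], ht.2⟩
  have h := intervalIntegral.integral_comp_mul_deriv' (a := 0) (b := s)
    (g := fun t : ℝ ↦ (1 + t ^ q) ^ (-(1 / p)))
    (fun t ht ↦ hasDerivAt_sinToSinh hq (hsub ht))
    ((continuousOn_one_sub_rpow_rpow hq0 _).mono hsub')
    ((continuousOn_one_add_rpow_rpow hq0 _).mono
      (image_subset_iff.2 fun t ht ↦ sinToSinh_nonneg hq0 (hsub ht)))
  have h0 : sinToSinh q 0 = 0 := by simp [sinToSinh]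
  rw [h0] at h
  rw [genG, genF, ← h]
  refine intervalIntegral.integral_congr fun t ht ↦ ?_
  have hpos := one_sub_rpow_pos hq0 (hsub' ht)
  simp only [Function.comp_apply]
  rw [one_add_sinToSinh_rpow hq0 (hsub ht), Real.inv_rpow hpos.le, ← Real.rpow_neg hpos.le,
    ← Real.rpow_add hpos]
  congr 1
  linarith

lemma gsinh_genF {p q r : ℝ} (hq : 1 < q) (hr : 1 / r = 1 + 1 / q - 1 / p) {s : ℝ}
    (hs : s ∈ Ico (0 : ℝ) 1) : gsinh p q (genF r q s) = sinToSinh q s := by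
  rw [← genG_sinToSinh hq hr hs]
  exact (strictMonoOn_genG p (zero_lt_one.trans hq)).injOn.leftInvOn_invFunOn
    (sinToSinh_nonneg (zero_lt_one.trans hq) hs)

/-- for `q/(q+1) < p < ∞`, `1 < q < ∞`, `r = pq/(pq+p-q)` and
`x ∈ [0, π_{r,q}/2)`, `cosh_{p,q} x = 1 / (cos_{r,q} x)^(r/p)`. -/
theorem cosh_eq_one_div_cos_rpow (p q r : ℝ) (hq : 1 < q) (hp : q / (q + 1) < p)
    (hr : r = p * q / (p * q + p - q)) (x : ℝ) (hx0 : 0 ≤ x)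
    (hx : ENNReal.ofReal x < genPi r q / 2) :
    gcosh p q x = 1 / gcos r q x ^ (r / p) := by
  have hq0 : 0 < q := zero_lt_one.trans hq
  have hp0 : 0 < p := lt_trans (by positivity) hp
  have hden : 0 < p * q + p - q := by
    rw [div_lt_iff₀ (by linarith)] at hp
    linarith
  have hr0 : 0 < r := by rw [hr]; positivity
  have hr1 : 1 / r = 1 + 1 / q - 1 / p := by
    rw [hr]
    field_simp
  obtain ⟨y, hy, hxy⟩ := exists_lt_genF r hq0 hx0 hx
  obtain ⟨s, hs, rfl⟩ := exists_genF_eq r hq0 hy hx0 hxy.le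
  have hpos := one_sub_rpow_pos hq0 (s := s) ⟨by linarith [hs.1], hs.2⟩
  have hsin := hasDerivWithinAt_gsin hq0 hr0 hs hy hxy
  have huniq : UniqueDiffWithinAt ℝ (Ici 0) (genF r q s) := uniqueDiffOn_Ici 0 _ hx0
  have hcomp : HasDerivWithinAt (sinToSinh q ∘ gsin r q)
      ((1 - s ^ q) ^ (-(1 / q) - 1) * (1 - s ^ q) ^ (1 / r)) (Ici 0) (genF r q s) := by
    refine HasDerivAt.comp_hasDerivWithinAt _ ?_ hsin
    rw [gsin_genF hq0 hr0 hs]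
    exact hasDerivAt_sinToSinh hq hs
  have hsinh : gsinh p q =ᶠ[nhdsWithin (genF r q s) (Ici 0)] sinToSinh q ∘ gsin r q := by
    filter_upwards [self_mem_nhdsWithin, mem_nhdsWithin_of_mem_nhds (Iio_mem_nhds hxy)]
      with u hu hu'
    obtain ⟨v, hv, rfl⟩ := exists_genF_eq r hq0 hy hu (le_of_lt hu')
    rw [Function.comp_apply, gsinh_genF hq hr1 hv, gsin_genF hq0 hr0 hv]
  rw [gcosh, gcos, hsin.derivWithin huniq,
    (hcomp.congr_of_eventuallyEq_of_mem hsinh hx0).derivWithin huniq,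
    ← Real.rpow_mul hpos.le, ← Real.rpow_add hpos, one_div (_ ^ _),
    ← Real.rpow_neg hpos.le]
  congr 1
  rw [show 1 / r * (r / p) = 1 / p by field_simp]
  linarith
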